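/- Suppose f : ℝ → ℝ solves the safe-integration equation for (g₀, h₀, h₁). If g₀ is an integer (i.e. g₀ ∈ ℤ viewed inside ℝ) and h₀ and h₁ map pairs of integers to integers (for all a, b ∈ ℤ, h₀(a, b) ∈ ℤ and h₁(a, b) ∈ ℤ, viewed inside ℝ), then f(n) is an integer for every n ∈ ℕ; that is, safe integration preserves the integers. -/

import Mathlib

noncomputable def parity (x : ℝ) : ℝ := max 0 (Real.pi / 2 * Real.sin (Real.pi * x))

noncomputable def pfun (x : ℝ) : ℝ := ∫ t in (0:ℝ)..(x - 1), parity t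

noncomputable def pfun' (x : ℝ) : ℝ := pfun (x - 1) + 1

def SolvesSafeIntegration (g0 : ℝ) (h0 h1 : ℝ → ℝ → ℝ) (f : ℝ → ℝ) : Prop :=
  f 0 = g0 ∧ ∀ x : ℝ, HasDerivAt f
    (parity x * (h1 (pfun x) (f (pfun x)) - f (2 * pfun x)) +
     parity (x - 1) * (h0 (pfun' x) (f (pfun' x)) - f (2 * pfun' x - 1))) x

theorem continuous_parity : Continuous parity := by
  unfold parity
  fun_prop

theorem parity_periodic : Function.Periodic parity 2 := by
  intro x
  have h : Real.pi * (x + 2) = Real.pi * x + 2 * Real.pi := by ring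
  simp only [parity, h, Real.sin_add_two_pi]

theorem parity_add_two_mul_nat (x : ℝ) (k : ℕ) : parity (x + 2 * k) = parity x := by
  rw [mul_comm]
  exact parity_periodic.nat_mul k x

theorem parity_of_mem_Icc_zero_one {x : ℝ} (hx : x ∈ Set.Icc (0 : ℝ) 1) :
    parity x = Real.pi / 2 * Real.sin (Real.pi * x) := by
  have hpi := Real.pi_pos
  refine max_eq_right (mul_nonneg (by positivity) (Real.sin_nonneg_of_nonneg_of_le_pi ?_ ?_))
  · exact mul_nonneg hpi.le hx.1
  · nlinarith [hx.2]

theorem parity_of_mem_Icc_neg_one_zero {x : ℝ} (hx : x ∈ Set.Icc (-1 : ℝ) 0) :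
    parity x = 0 := by
  have hpi := Real.pi_pos
  refine max_eq_left (mul_nonpos_of_nonneg_of_nonpos (by positivity)
    (Real.sin_nonpos_of_nonpos_of_neg_pi_le ?_ ?_))
  · exact mul_nonpos_of_nonneg_of_nonpos hpi.le hx.2
  · nlinarith [hx.1]

theorem parity_eq_zero {x : ℝ} {k : ℕ} (hx : x ∈ Set.Icc (2 * k - 1 : ℝ) (2 * k)) :
    parity x = 0 := by
  rw [← sub_add_cancel x (2 * k : ℝ), parity_add_two_mul_nat]
  exact parity_of_mem_Icc_neg_one_zero ⟨by linarith [hx.1], by linarith [hx.2]⟩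

theorem integral_parity_zero_one : ∫ t in (0 : ℝ)..1, parity t = 1 := by
  have h : Set.EqOn parity (fun t => Real.pi / 2 * Real.sin (Real.pi * t)) (Set.uIcc 0 1) := by
    intro t ht
    rw [Set.uIcc_of_le zero_le_one] at ht
    exact parity_of_mem_Icc_zero_one ht
  rw [intervalIntegral.integral_congr h, intervalIntegral.integral_const_mul,
    intervalIntegral.integral_comp_mul_left _ Real.pi_ne_zero, mul_zero, mul_one, integral_sin]
  have := Real.pi_ne_zero
  simp only [Real.cos_zero, Real.cos_pi, smul_eq_mul]
  field_simp
  norm_num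

theorem integral_parity_even_odd (k : ℕ) :
    ∫ t in (2 * k : ℝ)..(2 * k + 1), parity t = 1 := by
  have h := intervalIntegral.integral_comp_add_right (a := 0) (b := 1) parity (2 * k : ℝ)
  simp only [parity_add_two_mul_nat, integral_parity_zero_one] at h
  rw [zero_add, add_comm 1] at h
  exact h.symm

theorem integral_parity_eq_zero {a b : ℝ} {k : ℕ} (ha : a ∈ Set.Icc (2 * k - 1 : ℝ) (2 * k))
    (hb : b ∈ Set.Icc (2 * k - 1 : ℝ) (2 * k)) : ∫ t in a..b, parity t = 0 := by
  have h : Set.EqOn parity (fun _ => 0) (Set.uIcc a b) :=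
    fun t ht => parity_eq_zero (Set.uIcc_subset_Icc ha hb ht)
  rw [intervalIntegral.integral_congr h, intervalIntegral.integral_zero]

theorem integral_parity_zero_two_mul (k : ℕ) : ∫ t in (0 : ℝ)..(2 * k), parity t = k := by
  have hint (a b : ℝ) : IntervalIntegrable parity MeasureTheory.volume a b :=
    continuous_parity.intervalIntegrable a b
  induction k with
  | zero => simp
  | succ k ih =>
    have h : ∫ t in (2 * k + 1 : ℝ)..(2 * (k + 1 : ℕ)), parity t = 0 := by
      apply integral_parity_eq_zero (k := k + 1) <;> push_cast <;> constructor <;> linarith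
    rw [← intervalIntegral.integral_add_adjacent_intervals (hint 0 (2 * k)) (hint _ _), ih,
      ← intervalIntegral.integral_add_adjacent_intervals (hint _ (2 * k + 1)) (hint _ _), h,
      integral_parity_even_odd]
    push_cast
    ring

theorem pfun_eq {x : ℝ} {k : ℕ} (hx : x ∈ Set.Icc (2 * k : ℝ) (2 * k + 1)) : pfun x = k := by
  have h : ∫ t in (2 * k : ℝ)..(x - 1), parity t = 0 := by
    apply integral_parity_eq_zero (k := k) <;> constructor <;> linarith [hx.1, hx.2]
  rw [pfun, ← intervalIntegral.integral_add_adjacent_intervals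
    (continuous_parity.intervalIntegrable 0 (2 * k))
    (continuous_parity.intervalIntegrable _ _), h, integral_parity_zero_two_mul, add_zero]

section

variable {g0 : ℝ} {h0 h1 : ℝ → ℝ → ℝ} {f : ℝ → ℝ}

theorem SolvesSafeIntegration.apply_odd (hf : SolvesSafeIntegration g0 h0 h1 f) (k : ℕ) :
    f (2 * k + 1) = h1 k (f k) := by
  have hd : ∀ x ∈ Set.uIcc (2 * k : ℝ) (2 * k + 1),
      HasDerivAt f (parity x * (h1 k (f k) - f (2 * k))) x := by
    intro x hx
    rw [Set.uIcc_of_le (by linarith)] at hx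
    have hp : parity (x - 1) = 0 := parity_eq_zero (k := k) ⟨by linarith [hx.1], by linarith [hx.2]⟩
    simpa only [pfun_eq hx, hp, zero_mul, add_zero] using hf.2 x
  have h := intervalIntegral.integral_eq_sub_of_hasDerivAt hd
    ((continuous_parity.mul continuous_const).intervalIntegrable _ _)
  rw [intervalIntegral.integral_mul_const, integral_parity_even_odd] at h
  linarith

theorem SolvesSafeIntegration.apply_even_succ (hf : SolvesSafeIntegration g0 h0 h1 f) (k : ℕ) :
    f (2 * k + 2) = h0 (k + 1) (f (k + 1)) := by
  have hd : ∀ x ∈ Set.uIcc (2 * k + 1 : ℝ) (2 * k + 2),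
      HasDerivAt f (parity (x - 1) * (h0 (k + 1) (f (k + 1)) - f (2 * k + 1))) x := by
    intro x hx
    rw [Set.uIcc_of_le (by linarith)] at hx
    have hp : parity x = 0 := by
      apply parity_eq_zero (k := k + 1)
      push_cast
      constructor <;> linarith [hx.1, hx.2]
    have hp' : pfun' x = k + 1 := by
      rw [pfun', pfun_eq (k := k) ⟨by linarith [hx.1], by linarith [hx.2]⟩]
    have he : (2 * (k + 1) - 1 : ℝ) = 2 * k + 1 := by ring
    simpa only [hp', hp, he, zero_mul, zero_add] using hf.2 x
  have h := intervalIntegral.integral_eq_sub_of_hasDerivAt hd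
    (Continuous.intervalIntegrable
      ((continuous_parity.comp (continuous_sub_right 1)).mul continuous_const) _ _)
  have he : (2 * k + 2 - 1 : ℝ) = 2 * k + 1 := by ring
  rw [intervalIntegral.integral_mul_const, intervalIntegral.integral_comp_sub_right parity,
    add_sub_cancel_right, he, integral_parity_even_odd] at h
  linarith

end

theorem safe_integration_preserves_integers (g0 : ℝ) (h0 h1 : ℝ → ℝ → ℝ) (f : ℝ → ℝ)
    (hf : SolvesSafeIntegration g0 h0 h1 f)
    (hg : ∃ a : ℤ, g0 = a)
    (hh0 : ∀ a b : ℤ, ∃ c : ℤ, h0 a b = c)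
    (hh1 : ∀ a b : ℤ, ∃ c : ℤ, h1 a b = c) :
    ∀ n : ℕ, ∃ m : ℤ, f n = m := by
  intro n
  induction n using Nat.strong_induction_on with
  | _ n ih =>
    obtain ⟨k, rfl | rfl⟩ := n.even_or_odd'
    · cases k with
      | zero =>
        obtain ⟨a, ha⟩ := hg
        exact ⟨a, by simpa using hf.1.trans ha⟩
      | succ k =>
        obtain ⟨b, hb⟩ := ih (k + 1) (by lia)
        obtain ⟨c, hc⟩ := hh0 (k + 1 : ℕ) b
        refine ⟨c, ?_⟩
        rw [← hc, ← hb]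
        have h := hf.apply_even_succ k
        push_cast
        rw [← h]
        ring_nf
    · obtain ⟨b, hb⟩ := ih k (by lia)
      obtain ⟨c, hc⟩ := hh1 k b
      refine ⟨c, ?_⟩
      rw [← hc, ← hb]
      exact_mod_cast hf.apply_odd k
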